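/- arXiv:1707.04731 — 2 statements merged into one kernel-verified Lean document; each statement's English description precedes it below -/
import Mathlib

section
/- Let ε ≥ 0, let x be an integral allocation, and let p be a price vector with p_j > 0 for every good j, for a fair division instance with additive nonnegative valuations, such that (1) x is ε-pEF1 with respect to p, and (2) x_i ⊆ MBB_i for every agent i. Then x is ε-EF1. -/
open Finset

/-- The bundle of agent `k` under the integral allocation `a`. -/
def bundle {n m : ℕ} (a : Fin m → Fin n) (k : Fin n) : Finset (Fin m) :=
  Finset.univ.filter (fun j => a j = k)

/-- Additive value of agent `i` for a set of goods (real valuations). -/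
def valR {n m : ℕ} (v : Fin n → Fin m → ℝ) (i : Fin n) (S : Finset (Fin m)) : ℝ :=
  ∑ j ∈ S, v i j

/-- Spending of agent `k`: total price of its bundle. -/
def spend {n m : ℕ} (p : Fin m → ℝ) (a : Fin m → Fin n) (k : Fin n) : ℝ :=
  ∑ j ∈ bundle a k, p j

/-- If agent `i` holds only maximum bang-per-buck goods, then price bounds relative to its
spending transfer to value bounds relative to the value of its bundle. -/
theorem valR_le_mul_valR_bundle {n m : ℕ} {v : Fin n → Fin m → ℝ} {p : Fin m → ℝ}
    (hv : ∀ i j, 0 ≤ v i j) (hp : ∀ j, 0 < p j) {a : Fin m → Fin n} {i : Fin n}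
    (hMBB : ∀ j ∈ bundle a i, ∀ l : Fin m, v i l / p l ≤ v i j / p j)
    {c : ℝ} {S : Finset (Fin m)} (hS : ∑ j ∈ S, p j ≤ c * spend p a i) :
    valR v i S ≤ c * valR v i (bundle a i) := by
  rcases (bundle a i).eq_empty_or_nonempty with h | ⟨j₀, hj₀⟩
  · have hS_empty : S = ∅ := by
      by_contra hne
      have hpos : 0 < ∑ j ∈ S, p j :=
        Finset.sum_pos (fun j _ => hp j) (Finset.nonempty_iff_ne_empty.mpr hne)
      simp only [spend, h, Finset.sum_empty, mul_zero] at hS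
      linarith
    simp [valR, h, hS_empty]
  · set r := v i j₀ / p j₀
    have hr_nonneg : 0 ≤ r := div_nonneg (hv i j₀) (hp j₀).le
    have hle : valR v i S ≤ r * ∑ j ∈ S, p j := by
      rw [valR, Finset.mul_sum]
      exact Finset.sum_le_sum fun l _ => (div_le_iff₀ (hp l)).mp (hMBB j₀ hj₀ l)
    have heq : valR v i (bundle a i) = r * spend p a i := by
      rw [valR, spend, Finset.mul_sum]
      refine Finset.sum_congr rfl fun l hl => (div_eq_iff (hp l).ne').mp ?_
      exact le_antisymm (hMBB j₀ hj₀ l) (hMBB l hl j₀)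
    calc valR v i S ≤ r * ∑ j ∈ S, p j := hle
      _ ≤ r * (c * spend p a i) := mul_le_mul_of_nonneg_left hS hr_nonneg
      _ = c * valR v i (bundle a i) := by rw [heq]; ring

/-- If `x` is ε-pEF1 with respect to positive prices `p` and every agent's bundle
consists of maximum bang-per-buck goods, then `x` is ε-EF1. -/
theorem eps_pEF1_implies_eps_EF1 (n m : ℕ) (ε : ℝ) (hε : 0 ≤ ε)
    (v : Fin n → Fin m → ℝ) (hv : ∀ i j, 0 ≤ v i j)
    (p : Fin m → ℝ) (hp : ∀ j, 0 < p j)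
    (a : Fin m → Fin n)
    (hpEF1 : ∀ i k : Fin n,
      spend p a k ≤ (1 + ε) * spend p a i ∨
        ∃ j ∈ bundle a k, (∑ j' ∈ (bundle a k).erase j, p j') ≤ (1 + ε) * spend p a i)
    (hMBB : ∀ i : Fin n, ∀ j ∈ bundle a i, ∀ l : Fin m, v i l / p l ≤ v i j / p j) :
    ∀ i k : Fin n,
      valR v i (bundle a k) ≤ (1 + ε) * valR v i (bundle a i) ∨
        ∃ j ∈ bundle a k,
          valR v i ((bundle a k).erase j) ≤ (1 + ε) * valR v i (bundle a i) := by
  intro i k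
  rcases hpEF1 i k with h | ⟨j, hj, h⟩
  · exact Or.inl (valR_le_mul_valR_bundle hv hp (hMBB i) h)
  · exact Or.inr ⟨j, hj, valR_le_mul_valR_bundle hv hp (hMBB i) h⟩
end

section
/- Let x be an allocation in a fair division instance in which all n agents share the same additive nonnegative valuation v, and let ε ≥ 0. If x is ε-EF1, then NSW(x) ≥ e^{-(1+ε)/e} · NSW(x*), where x* is a Nash optimal allocation; i.e., an ε-EF1 allocation provides an e^{(1+ε)/e}-approximation to the maximum Nash social welfare. -/
open Finset

/-- Nash social welfare of an integral allocation, for identical additive valuation `v`. -/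
noncomputable def NSWid {n m : ℕ} (v : Fin m → ℝ) (a : Fin m → Fin n) : ℝ :=
  (∏ i : Fin n, ∑ j ∈ bundle a i, v j) ^ ((n : ℝ)⁻¹)

lemma log_add_one_sub_le_sum {ι : Type*} (S : Finset ι) (x : ι → ℝ)
    (hx : ∀ i ∈ S, 1 ≤ x i) (u : ℝ) (hu : 0 < u) (hS : ∑ i ∈ S, x i ≤ u) :
    Real.log u + 1 - u ≤ ∑ i ∈ S, (Real.log (x i) + 1 - x i) := by
  classical
  induction S using Finset.induction_on generalizing u with
  | empty =>
    have := Real.log_le_sub_one_of_pos hu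
    simp only [sum_empty]
    linarith
  | insert b S hb ih =>
    rw [sum_insert hb] at hS ⊢
    have hxb : 1 ≤ x b := hx b (mem_insert_self b S)
    have hxS : ∀ i ∈ S, 1 ≤ x i := fun i hi => hx i (mem_insert_of_mem hi)
    have hxb0 : x b ≠ 0 := by positivity
    rcases S.eq_empty_or_nonempty with rfl | ⟨c, hc⟩
    · simp only [sum_empty, add_zero] at hS ⊢
      have h1 := Real.log_le_sub_one_of_pos (div_pos hu (by linarith : 0 < x b))
      rw [Real.log_div hu.ne' hxb0] at h1
      have h2 : u / x b - 1 ≤ u - x b := by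
        rw [div_sub_one hxb0, div_le_iff₀ (by linarith)]
        nlinarith
      linarith
    · have hc1 : x c ≤ ∑ i ∈ S, x i :=
        single_le_sum (fun i hi => zero_le_one.trans (hxS i hi)) hc
      have hu1 : 1 ≤ u - x b := by linarith [hxS c hc]
      have h1 := ih hxS (u - x b) (by linarith) (by linarith)
      have h2 : Real.log u ≤ Real.log (x b) + Real.log (u - x b) + 1 := by
        have h3 : u ≤ x b * (u - x b) * 2 := by nlinarith
        have h4 := Real.log_le_log hu h3
        rw [Real.log_mul (by nlinarith) two_ne_zero,
          Real.log_mul hxb0 (by linarith)] at h4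
        have h5 := Real.log_le_sub_one_of_pos (two_pos (α := ℝ))
        linarith
      linarith

/-- If the goods of value `w k > α` are spread over bundles of value `u i`, the total value being
`∑ k, max (w k) α`, then the product of the `u i` is at most that of the water-filled values
`max (w k) α`. -/
lemma sum_log_le_sum_log_max {ι : Type*} [Fintype ι] [DecidableEq ι] (w u : ι → ℝ) (σ : ι → ι)
    (α : ℝ) (hα : 0 < α) (hu : ∀ i, 0 < u i)
    (hw : ∀ i, ∑ k ∈ univ.filter (fun k => α < w k) with σ k = i, w k ≤ u i)
    (htot : ∑ i, u i = ∑ k, max (w k) α) :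
    ∑ i, Real.log (u i) ≤ ∑ k, Real.log (max (w k) α) := by
  have hle : ∀ i, Real.log (u i / α) + 1 - u i / α ≤
      ∑ k ∈ univ.filter (fun k => α < w k) with σ k = i,
        (Real.log (w k / α) + 1 - w k / α) := by
    intro i
    apply log_add_one_sub_le_sum
    · intro k hk
      simp only [mem_filter, mem_univ, true_and] at hk
      rw [le_div_iff₀ hα]
      linarith [hk.1]
    · exact div_pos (hu i) hα
    · rw [← sum_div]
      exact div_le_div_of_nonneg_right (hw i) hα.le
  have h1 := sum_le_sum (fun i (_ : i ∈ univ) => hle i)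
  rw [sum_fiberwise, sum_filter] at h1
  have h2 : ∀ k, (if α < w k then Real.log (w k / α) + 1 - w k / α else 0) =
      Real.log (max (w k) α) - Real.log α + 1 - max (w k) α / α := by
    intro k
    split_ifs with h
    · rw [max_eq_left h.le, Real.log_div (hα.trans h).ne' hα.ne']
    · rw [max_eq_right (not_lt.1 h), div_self hα.ne']
      ring
  simp only [h2, Real.log_div (hu _).ne' hα.ne', sum_sub_distrib, sum_add_distrib,
    ← sum_div, htot] at h1
  linarith

lemma log_le_div_exp_one {t : ℝ} (ht : 0 < t) : Real.log t ≤ t / Real.exp 1 := by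
  have h := Real.log_le_sub_one_of_pos (div_pos ht (Real.exp_pos 1))
  rw [Real.log_div ht.ne' (Real.exp_pos 1).ne', Real.log_exp] at h
  linarith

/-- The chord bound for `log`, relaxed at the right end point. -/
lemma log_sub_log_le_chord {α l c y : ℝ} (hl : 0 < l) (hα : l ≤ α) (hc : l ≤ c)
    (hy : l ≤ y) (hyc : y ≤ α + c) :
    Real.log α - Real.log y ≤
      (Real.log α - Real.log l) * ((α + c - y) / (α + c - l)) := by
  have hD : 0 < α + c - l := by linarith
  have h := strictConcaveOn_log_Ioi.concaveOn.2 (Set.mem_Ioi.2 hl)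
    (Set.mem_Ioi.2 (by linarith : 0 < α + c))
    (div_nonneg (by linarith) hD.le : 0 ≤ (α + c - y) / (α + c - l))
    (div_nonneg (by linarith) hD.le : 0 ≤ (y - l) / (α + c - l))
    (by rw [← add_div, div_eq_one_iff_eq hD.ne']; ring)
  simp only [smul_eq_mul] at h
  have he : (α + c - y) / (α + c - l) * l + (y - l) / (α + c - l) * (α + c) = y := by
    field_simp
    ring
  rw [he] at h
  have hb : (y - l) / (α + c - l) = 1 - (α + c - y) / (α + c - l) := by
    field_simp
    ring
  have hlog : Real.log α ≤ Real.log (α + c) :=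
    Real.log_le_log (by linarith) (by linarith)
  have h3 := mul_le_mul_of_nonneg_left hlog
    (div_nonneg (by linarith) hD.le : 0 ≤ (y - l) / (α + c - l))
  rw [hb] at h h3
  linarith

/-- Bundle values `y` which exceed the value `w` of a single good by at most `δ` times the smallest
bundle value `l` have a product close to that of their water-filled counterpart. -/
lemma sum_log_max_le {ι : Type*} [Fintype ι] (w y : ι → ℝ) (α l δ : ℝ) (hl : 0 < l)
    (hδ : 1 ≤ δ) (hα : l ≤ α) (hy : ∀ k, l ≤ y k) (hwy : ∀ k, w k ≤ y k)
    (hyw : ∀ k, y k ≤ w k + δ * l) (htot : ∑ k, y k = ∑ k, max (w k) α) :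
    ∑ k, Real.log (max (w k) α) ≤
      Fintype.card ι * (δ / Real.exp 1) + ∑ k, Real.log (y k) := by
  have hlδ : l ≤ δ * l := le_mul_of_one_le_left hl.le hδ
  have hα0 : 0 < α := hl.trans_le hα
  have hD : 0 < α + δ * l - l := by linarith
  have hlog : 0 ≤ Real.log α - Real.log l := sub_nonneg.2 (Real.log_le_log hl hα)
  have hle : ∀ k, Real.log (max (w k) α) - Real.log (y k) ≤
      (Real.log α - Real.log l) * ((max (w k) α + δ * l - y k) / (α + δ * l - l)) := by
    intro k
    rcases le_total (w k) α with h | h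
    · rw [max_eq_right h]
      exact log_sub_log_le_chord hl hα hlδ (hy k) ((hyw k).trans (by linarith))
    · rw [max_eq_left h]
      have h1 := Real.log_le_log (hα0.trans_le h) (hwy k)
      have h2 : 0 ≤ (w k + δ * l - y k) / (α + δ * l - l) :=
        div_nonneg (by linarith [hyw k]) hD.le
      linarith [mul_nonneg hlog h2]
  have h1 := sum_le_sum (fun k (_ : k ∈ univ) => hle k)
  rw [← mul_sum, ← sum_div, sum_sub_distrib, sum_sub_distrib, sum_add_distrib, htot,
    sum_const, nsmul_eq_mul, card_univ] at h1
  have h2 : (Real.log α - Real.log l) * (δ * l / (α + δ * l - l)) ≤ δ / Real.exp 1 := by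
    have h3 := log_le_div_exp_one (div_pos hα0 hl)
    rw [Real.log_div hα0.ne' hl.ne'] at h3
    calc (Real.log α - Real.log l) * (δ * l / (α + δ * l - l))
        ≤ (α / l / Real.exp 1) * (δ * l / α) := by
          gcongr
          linarith
      _ = δ / Real.exp 1 := by field_simp
  have h4 := mul_le_mul_of_nonneg_left h2 (Nat.cast_nonneg (α := ℝ) (Fintype.card ι))
  have h5 : (Real.log α - Real.log l) * ((∑ k, max (w k) α + Fintype.card ι * (δ * l)
      - ∑ k, max (w k) α) / (α + δ * l - l)) =
      Fintype.card ι * ((Real.log α - Real.log l) * (δ * l / (α + δ * l - l))) := by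
    ring
  linarith

lemma exists_sum_max_eq {ι : Type*} [Fintype ι] [Nonempty ι] (w y : ι → ℝ) (l : ℝ) (hl : 0 ≤ l)
    (hy : ∀ k, l ≤ y k) (hwy : ∀ k, w k ≤ y k) :
    ∃ α, l ≤ α ∧ ∑ k, y k = ∑ k, max (w k) α := by
  obtain ⟨i⟩ := ‹Nonempty ι›
  have hs : ∀ k, y k ≤ ∑ k, y k := fun k =>
    single_le_sum (fun i _ => hl.trans (hy i)) (mem_univ k)
  have hc : Continuous fun α : ℝ => ∑ k, max (w k) α := by fun_prop
  obtain ⟨α, hα, he⟩ := intermediate_value_Icc ((hy i).trans (hs i)) hc.continuousOn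
    (⟨sum_le_sum fun k _ => max_le (hwy k) (hy k),
      sum_le_sum fun k _ => (hs k).trans (le_max_right _ _)⟩ :
      ∑ k, y k ∈ Set.Icc (∑ k, max (w k) l) (∑ k, max (w k) (∑ k, y k)))
  exact ⟨α, hα.1, he.symm⟩

@[simp]
lemma mem_bundle {n m : ℕ} (a : Fin m → Fin n) (k : Fin n) (j : Fin m) :
    j ∈ bundle a k ↔ a j = k := by
  simp [bundle]

lemma sum_sum_bundle {n m : ℕ} (v : Fin m → ℝ) (a : Fin m → Fin n) :
    ∑ k, ∑ j ∈ bundle a k, v j = ∑ j, v j :=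
  sum_fiberwise univ a v

/-- If an agent has a worthless bundle in an ε-EF1 allocation, every allocation leaves some agent
with a worthless bundle. -/
lemma exists_sum_bundle_eq_zero {n m : ℕ} (v : Fin m → ℝ) (hv : ∀ j, 0 ≤ v j)
    (a b : Fin m → Fin n) (i : Fin n) (hi : ∑ j ∈ bundle a i, v j = 0)
    (hEF1 : ∀ k, ∑ j ∈ bundle a k, v j ≤ 0 ∨
      ∃ j ∈ bundle a k, ∑ j' ∈ (bundle a k).erase j, v j' ≤ 0) :
    ∃ k, ∑ j ∈ bundle b k, v j = 0 := by
  by_contra! hne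
  have hpos : ∀ k, ∃ j, b j = k ∧ v j ≠ 0 := by
    intro k
    obtain ⟨j, hj, hj0⟩ := exists_ne_zero_of_sum_ne_zero (hne k)
    exact ⟨j, (mem_bundle b k j).1 hj, hj0⟩
  choose g hbg hg using hpos
  have hzero : ∀ S : Finset (Fin m), ∑ j ∈ S, v j ≤ 0 → ∀ j ∈ S, v j = 0 := fun S hS =>
    (sum_eq_zero_iff_of_nonneg fun j _ => hv j).1 (hS.antisymm (sum_nonneg fun j _ => hv j))
  have hinj : Function.Injective fun k => a (g k) := by
    intro k k' hkk
    simp only at hkk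
    by_contra hk
    have hgk : g k ≠ g k' := fun h => hk (by rw [← hbg k, ← hbg k', h])
    rcases hEF1 (a (g k)) with h | ⟨j, -, h⟩
    · exact hg k (hzero _ h _ (by simp))
    · by_cases hj : g k = j
      · exact hg k' (hzero _ h _ (by simp [← hj, hgk.symm, hkk]))
      · exact hg k (hzero _ h _ (by simp [hj]))
  obtain ⟨k, hk⟩ := Finite.surjective_of_injective hinj i
  exact hg k (hzero _ hi.le _ (by simpa using hk))

lemma prod_bundle_le_of_pos {n m : ℕ} (v : Fin m → ℝ) (hv : ∀ j, 0 ≤ v j) (δ : ℝ) (hδ : 1 ≤ δ)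
    (a b : Fin m → Fin n) (i : Fin n) (hmin : ∀ k, ∑ j ∈ bundle a i, v j ≤ ∑ j ∈ bundle a k, v j)
    (hi : 0 < ∑ j ∈ bundle a i, v j) (hb : ∀ k, 0 < ∑ j ∈ bundle b k, v j)
    (hEF1 : ∀ k, ∑ j ∈ bundle a k, v j ≤ δ * ∑ j ∈ bundle a i, v j ∨
      ∃ j ∈ bundle a k, ∑ j' ∈ (bundle a k).erase j, v j' ≤ δ * ∑ j ∈ bundle a i, v j) :
    ∏ k, ∑ j ∈ bundle b k, v j ≤
      Real.exp (n * (δ / Real.exp 1)) * ∏ k, ∑ j ∈ bundle a k, v j := by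
  have hw : ∀ k, ∃ w, ∃ j, w ≤ ∑ j ∈ bundle a k, v j ∧
      ∑ j ∈ bundle a k, v j ≤ w + δ * ∑ j ∈ bundle a i, v j ∧
      (0 < w → a j = k ∧ v j = w) := by
    intro k
    rcases hEF1 k with h | ⟨j, hj, h⟩
    · obtain ⟨j, -, -⟩ := exists_ne_zero_of_sum_ne_zero hi.ne'
      exact ⟨0, j, hi.le.trans (hmin k), by linarith, fun h => absurd h (lt_irrefl 0)⟩
    · refine ⟨v j, j, single_le_sum (fun j _ => hv j) hj, ?_, fun _ => ⟨by simpa using hj, rfl⟩⟩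
      rw [← add_sum_erase _ _ hj]
      linarith
  choose w g hwy hyw hg using hw
  have : Nonempty (Fin n) := ⟨i⟩
  obtain ⟨α, hα, htot⟩ := exists_sum_max_eq w _ _ hi.le hmin hwy
  have hα0 := hi.trans_le hα
  have h1 := sum_log_max_le w _ α _ δ hi hδ hα hmin hwy hyw htot
  have h2 := sum_log_le_sum_log_max w (fun k => ∑ j ∈ bundle b k, v j) (fun k => b (g k)) α hα0 hb
    (fun k => by
      set K := (univ.filter (fun k => α < w k)).filter (fun k' => b (g k') = k) with hK
      have hKg : ∀ k' ∈ K, a (g k') = k' ∧ v (g k') = w k' := fun k' hk' =>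
        hg k' (hα0.trans (by simpa using (mem_filter.1 (mem_filter.1 hk').1).2))
      rw [← sum_congr rfl fun k' hk' => (hKg k' hk').2,
        ← sum_image (f := v) (g := g) (s := K) fun x hx y hy hxy => by
          rw [← (hKg x hx).1, ← (hKg y hy).1, hxy]]
      refine sum_le_sum_of_subset_of_nonneg ?_ fun j _ _ => hv j
      intro j hj
      obtain ⟨k', hk', rfl⟩ := mem_image.1 hj
      simpa using (mem_filter.1 hk').2)
    (by rw [← htot, sum_sum_bundle, sum_sum_bundle])
  have ha : ∀ k, 0 < ∑ j ∈ bundle a k, v j := fun k => hi.trans_le (hmin k)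
  rw [← Real.log_le_log_iff (prod_pos fun k _ => hb k)
    (mul_pos (Real.exp_pos _) (prod_pos fun k _ => ha k)),
    Real.log_mul (Real.exp_pos _).ne' (prod_pos fun k _ => ha k).ne', Real.log_exp,
    Real.log_prod fun k _ => (hb k).ne', Real.log_prod fun k _ => (ha k).ne']
  rw [Fintype.card_fin] at h1
  exact h2.trans h1

lemma prod_bundle_le {n m : ℕ} (hn : 0 < n) (v : Fin m → ℝ) (hv : ∀ j, 0 ≤ v j)
    (δ : ℝ) (hδ : 1 ≤ δ) (a b : Fin m → Fin n)
    (hEF1 : ∀ i k : Fin n, ∑ j ∈ bundle a k, v j ≤ δ * ∑ j ∈ bundle a i, v j ∨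
      ∃ j ∈ bundle a k, ∑ j' ∈ (bundle a k).erase j, v j' ≤ δ * ∑ j ∈ bundle a i, v j) :
    ∏ k, ∑ j ∈ bundle b k, v j ≤
      Real.exp (n * (δ / Real.exp 1)) * ∏ k, ∑ j ∈ bundle a k, v j := by
  have h0 : ∀ (c : Fin m → Fin n) k, 0 ≤ ∑ j ∈ bundle c k, v j :=
    fun c k => sum_nonneg fun j _ => hv j
  have : Nonempty (Fin n) := ⟨⟨0, hn⟩⟩
  by_cases hb : ∃ k, ∑ j ∈ bundle b k, v j = 0
  · obtain ⟨k, hk⟩ := hb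
    rw [prod_eq_zero (mem_univ k) hk]
    exact mul_nonneg (Real.exp_pos _).le (prod_nonneg fun k _ => h0 a k)
  obtain ⟨i, hmin⟩ := Finite.exists_min fun k => ∑ j ∈ bundle a k, v j
  have hi : ∑ j ∈ bundle a i, v j ≠ 0 := fun hi =>
    hb (exists_sum_bundle_eq_zero v hv a b i hi (by simpa [hi] using hEF1 i))
  push Not at hb
  exact prod_bundle_le_of_pos v hv δ hδ a b i hmin ((h0 a i).lt_of_ne' hi)
    (fun k => (h0 b k).lt_of_ne' (hb k)) (hEF1 i)

/-- Under identical additive nonnegative valuations, any ε-EF1 allocation provides an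
`e^{(1+ε)/e}`-approximation to the maximum Nash social welfare. -/
theorem eps_ef1_nsw_identical (n m : ℕ) (hn : 0 < n)
    (v : Fin m → ℝ) (hv : ∀ j, 0 ≤ v j)
    (ε : ℝ) (hε : 0 ≤ ε) (a : Fin m → Fin n)
    (hEF1 : ∀ i k : Fin n,
      (∑ j ∈ bundle a k, v j) ≤ (1 + ε) * ∑ j ∈ bundle a i, v j ∨
        ∃ j ∈ bundle a k,
          (∑ j' ∈ (bundle a k).erase j, v j') ≤ (1 + ε) * ∑ j ∈ bundle a i, v j)
    (xstar : Fin m → Fin n) (hopt : ∀ b : Fin m → Fin n, NSWid v b ≤ NSWid v xstar) :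
    Real.exp (-(1 + ε) / Real.exp 1) * NSWid v xstar ≤ NSWid v a := by
  have hn0 : (n : ℝ) ≠ 0 := Nat.cast_ne_zero.2 hn.ne'
  have h0 : ∀ b : Fin m → Fin n, 0 ≤ ∏ k, ∑ j ∈ bundle b k, v j :=
    fun b => prod_nonneg fun k _ => sum_nonneg fun j _ => hv j
  have h := Real.rpow_le_rpow (h0 xstar) (prod_bundle_le hn v hv (1 + ε) (by linarith) a xstar hEF1)
    (inv_nonneg.2 (Nat.cast_nonneg n))
  rw [Real.mul_rpow (Real.exp_pos _).le (h0 a), ← Real.exp_mul,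
    mul_right_comm, mul_inv_cancel₀ hn0, one_mul] at h
  rw [neg_div, Real.exp_neg, inv_mul_le_iff₀ (Real.exp_pos _)]
  exact h
end
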